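/- Let n, p be positive natural numbers, let C be a real p × n matrix, let P be a symmetric positive definite real n × n matrix, let θ be a symmetric real p × p matrix such that Cᵀ θ C is positive definite, and let α > 0 be a real number. Define N := -α P⁻¹ Cᵀ θ. Then P N C + Cᵀ Nᵀ P = -2α Cᵀ θ C, and in particular P N C + Cᵀ Nᵀ P is negative definite. -/

import Mathlib

open Matrix

/-- Theorem 3 of the paper, first half: with `N = -α P⁻¹ Cᵀ θ`, one has
`P N C + Cᵀ Nᵀ P = -2α Cᵀ θ C`, which is negative definite since `Cᵀ θ C` is
positive definite. -/
theorem cubic_observer_gain_negdef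
    (n p : ℕ) (hn : 0 < n) (hp : 0 < p)
    (C : Matrix (Fin p) (Fin n) ℝ)
    (P : Matrix (Fin n) (Fin n) ℝ) (hP : P.PosDef)
    (θ : Matrix (Fin p) (Fin p) ℝ) (hθ : θ.IsHermitian)
    (hCθC : (Cᵀ * θ * C).PosDef)
    (α : ℝ) (hα : 0 < α)
    (N : Matrix (Fin n) (Fin p) ℝ) (hN : N = (-α) • (P⁻¹ * Cᵀ * θ)) :
    P * N * C + Cᵀ * Nᵀ * P = (-(2 * α)) • (Cᵀ * θ * C) ∧
      ∀ v : Fin n → ℝ, v ≠ 0 →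
        v ⬝ᵥ (P * N * C + Cᵀ * Nᵀ * P) *ᵥ v < 0 := by
  have hdet : IsUnit P.det := hP.det_pos.ne'.isUnit
  have hPt : Pᵀ = P := by simpa using hP.isHermitian.eq
  have hθt : θᵀ = θ := by simpa using hθ.eq
  have hPNC : P * N * C = (-α) • (Cᵀ * θ * C) := by
    rw [hN, Matrix.mul_smul, Matrix.smul_mul, Matrix.mul_assoc P⁻¹, mul_nonsing_inv_cancel_left _ _ hdet]
  have hCNP : Cᵀ * Nᵀ * P = (P * N * C)ᵀ := by
    rw [transpose_mul, transpose_mul, hPt, Matrix.mul_assoc]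
  have hsymm : (Cᵀ * θ * C)ᵀ = Cᵀ * θ * C := by
    rw [transpose_mul, transpose_mul, hθt, transpose_transpose, Matrix.mul_assoc]
  have key : P * N * C + Cᵀ * Nᵀ * P = (-(2 * α)) • (Cᵀ * θ * C) := by
    rw [hCNP, hPNC, transpose_smul, hsymm, ← add_smul]
    congr 1
    ring
  refine ⟨key, fun v hv => ?_⟩
  have hpos : 0 < v ⬝ᵥ (Cᵀ * θ * C) *ᵥ v := by
    simpa using hCθC.dotProduct_mulVec_pos hv
  rw [key, smul_mulVec, dotProduct_smul, smul_eq_mul]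
  exact mul_neg_of_neg_of_pos (by linarith) hpos
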